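/- The infinite series sum over k ≥ 0 of (15k^2 - 124k - 40) * 8^k / ((4k+1) * binomial(4k, k)) converges to -10 - 3π/2. Equivalently, summing over k ≥ 1 gives 30 - 3π/2. -/

import Mathlib

lemma beta_aux (b : ℕ) : ∀ a : ℕ, (∫ x in (0:ℝ)..1, x^a * (1-x)^b) * ((a+b+1).factorial : ℝ)
    = a.factorial * b.factorial := by
  induction b with
  | zero =>
    intro a
    have h : (a:ℝ) + 1 ≠ 0 := by positivity
    simp [Nat.factorial_succ]
    field_simp
  | succ b ih =>
    intro a
    have h1 : ∫ x in (0:ℝ)..1, (((a:ℝ)+1) * (x^a * (1-x)^(b+1)) - ((b:ℝ)+1) * (x^(a+1) * (1-x)^b))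
        = 0 := by
      rw [intervalIntegral.integral_eq_sub_of_hasDerivAt (f := fun x => x^(a+1) * (1-x)^(b+1))]
      · simp
      · intro x _
        have := (hasDerivAt_pow (a+1) x).mul
          ((((hasDerivAt_id x).const_sub 1)).pow (b+1))
        convert! this using 1
        simp
        ring
      · apply Continuous.intervalIntegrable
        fun_prop
    rw [intervalIntegral.integral_sub, intervalIntegral.integral_const_mul,
      intervalIntegral.integral_const_mul] at h1
    · have h2 := ih (a+1)
      have h3 : a + 1 + b + 1 = a + (b+1) + 1 := by ring
      rw [h3, Nat.factorial_succ a] at h2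
      rw [Nat.factorial_succ b]
      push_cast at h2 ⊢
      have h : (a:ℝ) + 1 ≠ 0 := by positivity
      apply mul_left_cancel₀ h
      linear_combination ((a + (b+1) + 1).factorial : ℝ) * h1 + ((b:ℝ)+1) * h2
    · apply Continuous.intervalIntegrable
      fun_prop
    · apply Continuous.intervalIntegrable
      fun_prop

lemma beta_k (k : ℕ) : ∫ x in (0:ℝ)..1, (8*x^3*(1-x))^k
    = 8^k / ((4*(k:ℝ)+1) * (Nat.choose (4*k) k : ℝ)) := by
  have h := beta_aux k (3*k)
  have e : (fun x : ℝ => (8*x^3*(1-x))^k) = fun x => 8^k * (x^(3*k) * (1-x)^k) := by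
    funext x
    rw [mul_pow, mul_pow, ← pow_mul]; ring
  rw [e, intervalIntegral.integral_const_mul]
  have hc := Nat.choose_mul_factorial_mul_factorial (show k ≤ 4*k by omega)
  have h4 : 4*k - k = 3*k := by omega
  rw [h4] at hc
  have h5 : 3*k+k+1 = 4*k+1 := by ring
  rw [h5, Nat.factorial_succ, ← hc] at h
  push_cast at h
  have p1 : (0:ℝ) < (Nat.choose (4*k) k : ℝ) := by
    exact_mod_cast Nat.choose_pos (by omega)
  have p2 : ((k.factorial : ℕ):ℝ) ≠ 0 := by positivity
  have p3 : (((3*k).factorial : ℕ):ℝ) ≠ 0 := by positivity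
  have p4 : (4*(k:ℝ)+1) ≠ 0 := by positivity
  rw [eq_div_iff (by positivity), mul_assoc]
  apply mul_right_cancel₀ (mul_ne_zero p2 p3)
  linear_combination (8:ℝ)^k * h

lemma D_pos (x : ℝ) : 0 < 1 - 8*x^3*(1-x) := by
  nlinarith [sq_nonneg (4*x^2-2*x-1), sq_nonneg (2*x-1), sq_nonneg (x-1/2), sq_nonneg (x^2-x/2-9/32), sq_nonneg (x-3/4), sq_nonneg (x*(x-3/4))]

lemma geom (y : ℝ) (hy : ‖y‖ < 1) : HasSum (fun k : ℕ => (15*(k:ℝ)^2 - 124*(k:ℝ) - 40) * y^k)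
    ((30 - 169*(1-y) + 99*(1-y)^2)/(1-y)^3) := by
  have h0 := (hasSum_choose_mul_geometric_of_norm_lt_one 0 hy).mul_left 99
  have h1 := (hasSum_choose_mul_geometric_of_norm_lt_one 1 hy).mul_left (-169)
  have h2 := (hasSum_choose_mul_geometric_of_norm_lt_one 2 hy).mul_left 30
  have hD : 1 - y ≠ 0 := by
    have := (abs_lt.mp hy).2
    linarith
  convert! (h2.add h1).add h0 using 1
  · funext k
    rw [Nat.cast_choose_two]
    simp
    ring
  · field_simp
    ring

noncomputable def ff (x : ℝ) : ℝ :=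
  (30 - 169*(1-8*x^3*(1-x)) + 99*(1-8*x^3*(1-x))^2)/(1-8*x^3*(1-x))^3

lemma series : HasSum (fun k : ℕ => ∫ x in (0:ℝ)..1, (15*(k:ℝ)^2 - 124*(k:ℝ) - 40) * (8*x^3*(1-x))^k)
    (∫ x in (0:ℝ)..1, ff x) := by
  have hy : ∀ x : ℝ, x ∈ Set.uIoc (0:ℝ) 1 → ‖8*x^3*(1-x)‖ ≤ 27/32 := by
    intro x hx
    rw [Set.uIoc_of_le zero_le_one] at hx
    have h0 : 0 ≤ 1 - x := by linarith [hx.2]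
    have h1 := hx.1
    rw [Real.norm_of_nonneg (by positivity)]
    nlinarith [mul_nonneg (sq_nonneg (x-3/4)) (show 0 ≤ x^2+x/2+3/16 by positivity)]
  have hs : Summable (fun k : ℕ => (15*(k:ℝ)^2 + 124*(k:ℝ) + 40) * (27/32:ℝ)^k) := by
    have hr : ‖(27/32:ℝ)‖ < 1 := by norm_num [abs_of_pos]
    have s0 := (summable_pow_mul_geometric_of_norm_lt_one 0 hr).mul_left 40
    have s1 := (summable_pow_mul_geometric_of_norm_lt_one 1 hr).mul_left 124
    have s2 := (summable_pow_mul_geometric_of_norm_lt_one 2 hr).mul_left 15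
    convert! (s2.add s1).add s0 using 1
    funext k
    simp
    ring
  apply intervalIntegral.hasSum_integral_of_dominated_convergence
    (fun (k : ℕ) _ => (15*(k:ℝ)^2 + 124*(k:ℝ) + 40) * (27/32:ℝ)^k)
  · intro n
    apply Continuous.aestronglyMeasurable
    fun_prop
  · intro n
    filter_upwards with x hx
    rw [norm_mul, norm_pow]
    gcongr
    · rw [Real.norm_eq_abs, abs_le]
      have : (0:ℝ) ≤ n := by positivity
      constructor <;> nlinarith
    · exact hy x hx
  · filter_upwards with x hx
    exact hs
  · exact intervalIntegrable_const
  · filter_upwards with x hx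
    exact geom _ ((hy x hx).trans_lt (by norm_num))

noncomputable def RR (x : ℝ) : ℝ :=
  (5/2 - 37*x - 3*x^2 - 38*x^3 + 340*x^4 - 320*x^5 + 96*x^6 - 48*x^7)/(1-8*x^3*(1-x))^2

lemma RR_deriv (x : ℝ) : HasDerivAt RR (ff x - 3/2 * ((-4*x^2+4*x-2)/(1-8*x^3*(1-x)))) x := by
  have hD := (D_pos x).ne'
  have hp : ∀ n : ℕ, HasDerivAt (fun x : ℝ => x^n) (n * x^(n-1)) x := fun n => hasDerivAt_pow n x
  have hN : HasDerivAt (fun x : ℝ => 5/2 - 37*x - 3*x^2 - 38*x^3 + 340*x^4 - 320*x^5 + 96*x^6 - 48*x^7)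
      (-37 - 6*x - 114*x^2 + 1360*x^3 - 1600*x^4 + 576*x^5 - 336*x^6) x := by
    have := (((((((hasDerivAt_id x).const_mul 37).const_sub (5/2)).sub ((hp 2).const_mul 3)).sub
      ((hp 3).const_mul 38)).add ((hp 4).const_mul 340)).sub ((hp 5).const_mul 320)).add
      ((hp 6).const_mul 96) |>.sub ((hp 7).const_mul 48)
    convert! this using 1
    norm_num
    ring
  have hDD : HasDerivAt (fun x : ℝ => 1-8*x^3*(1-x)) (-24*x^2+32*x^3) x := by
    have := (((hp 3).const_mul 8).mul ((hasDerivAt_id x).const_sub 1)).const_sub 1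
    convert! this using 1
    norm_num
    ring
  convert! hN.div (hDD.pow 2) (pow_ne_zero 2 hD) using 1
  unfold ff
  simp only [Pi.pow_apply]
  field_simp
  ring

lemma arc_deriv (a b x : ℝ) (hab : a^2 + b^2 ≠ 0) (h : a*(2*x-1) + b*(4*x^2-2*x-1) ≠ 0) :
    HasDerivAt (fun x : ℝ => Real.arctan ((-a*(4*x^2-2*x-1) + b*(2*x-1))/(a*(2*x-1) + b*(4*x^2-2*x-1))))
      ((-4*x^2+4*x-2)/(1-8*x^3*(1-x))) x := by
  have hD := (D_pos x).ne'
  have hP : HasDerivAt (fun x : ℝ => 2*x-1) 2 x := by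
    simpa using ((hasDerivAt_id x).const_mul 2).sub_const 1
  have hQ : HasDerivAt (fun x : ℝ => 4*x^2-2*x-1) (8*x-2) x := by
    convert! (((hasDerivAt_pow 2 x).const_mul 4).sub ((hasDerivAt_id x).const_mul 2)).sub_const 1 using 1
    norm_num
    ring
  have := (((hQ.const_mul (-a)).add (hP.const_mul b)).div ((hP.const_mul a).add (hQ.const_mul b)) h).arctan
  convert! this using 1
  simp only [Pi.add_apply, Pi.div_apply]
  beta_reduce
  have key : (-a*(4*x^2-2*x-1) + b*(2*x-1))^2 + (a*(2*x-1) + b*(4*x^2-2*x-1))^2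
      = 2*(a^2+b^2)*(1-8*x^3*(1-x)) := by ring
  generalize hV : a*(2*x-1) + b*(4*x^2-2*x-1) = V at *
  generalize hU : -a*(4*x^2-2*x-1) + b*(2*x-1) = U at *
  have e : 1 + (U/V)^2 = 2*(a^2+b^2)*(1-8*x^3*(1-x)) / V^2 := by
    rw [← key]; field_simp; ring
  rw [e]
  field_simp
  rw [← hU, ← hV]
  ring

lemma ff_cont : Continuous ff := by
  unfold ff
  apply Continuous.div (by fun_prop) (by fun_prop)
  intro x
  exact pow_ne_zero 3 (D_pos x).ne'

lemma piece (a b u v : ℝ) (huv : u ≤ v) (hab : a^2 + b^2 ≠ 0)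
    (h : ∀ x ∈ Set.Icc u v, a*(2*x-1) + b*(4*x^2-2*x-1) ≠ 0) :
    ∫ x in u..v, ff x =
      (RR v + 3/2 * Real.arctan ((-a*(4*v^2-2*v-1) + b*(2*v-1))/(a*(2*v-1) + b*(4*v^2-2*v-1))))
      - (RR u + 3/2 * Real.arctan ((-a*(4*u^2-2*u-1) + b*(2*u-1))/(a*(2*u-1) + b*(4*u^2-2*u-1)))) := by
  apply intervalIntegral.integral_eq_sub_of_hasDerivAt (f := fun v =>
    RR v + 3/2 * Real.arctan ((-a*(4*v^2-2*v-1) + b*(2*v-1))/(a*(2*v-1) + b*(4*v^2-2*v-1))))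
  · intro x hx
    rw [Set.uIcc_of_le huv] at hx
    convert! (RR_deriv x).add ((arc_deriv a b x hab (h x hx)).const_mul (3/2)) using 1
    ring
  · exact ff_cont.intervalIntegrable _ _

lemma total : ∫ x in (0:ℝ)..1, ff x = -10 - 3*Real.pi/2 := by
  rw [← intervalIntegral.integral_add_adjacent_intervals (b := 1/2)
    (ff_cont.intervalIntegrable _ _) (ff_cont.intervalIntegrable _ _),
    piece 0 1 0 (1/2) (by norm_num) (by norm_num), piece 2 (-1) (1/2) 1 (by norm_num) (by norm_num)]
  · have h3 : Real.arctan 3 = Real.pi/2 - Real.arctan (3⁻¹) := by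
      rw [Real.arctan_inv_of_pos (by norm_num)]; ring
    have h2 : Real.arctan 2 = Real.pi/2 - Real.arctan (2⁻¹) := by
      rw [Real.arctan_inv_of_pos (by norm_num)]; ring
    have h4 : Real.arctan (2⁻¹) + Real.arctan (3⁻¹) = Real.pi/4 := by
      rw [Real.arctan_add (by norm_num)]; norm_num
    have r0 : RR 0 = 5/2 := by norm_num [RR]
    have r1 : RR 1 = -15/2 := by norm_num [RR]
    norm_num [r0, r1, Real.arctan_neg]
    rw [h3, h2]
    linarith
  · intro x hx
    have := hx.1
    have := hx.2
    nlinarith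
  · intro x hx
    have := hx.1
    have := hx.2
    nlinarith

theorem stmt_16 :
    HasSum (fun k : ℕ =>
      (15*(k:ℝ)^2 - 124*(k:ℝ) - 40) * 8^k / ((4*(k:ℝ)+1) * (Nat.choose (4*k) k : ℝ)))
      (-10 - 3*Real.pi/2) ∧
    HasSum (fun n : ℕ =>
      (15*((n:ℝ)+1)^2 - 124*((n:ℝ)+1) - 40) * 8^(n+1) /
        ((4*((n:ℝ)+1)+1) * (Nat.choose (4*(n+1)) (n+1) : ℝ)))
      (30 - 3*Real.pi/2) := by
  have h : HasSum (fun k : ℕ =>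
      (15*(k:ℝ)^2 - 124*(k:ℝ) - 40) * 8^k / ((4*(k:ℝ)+1) * (Nat.choose (4*k) k : ℝ)))
      (-10 - 3*Real.pi/2) := by
    have := series
    rw [total] at this
    convert! this using 1
    funext k
    rw [intervalIntegral.integral_const_mul, beta_k, mul_div_assoc]
  refine ⟨h, ?_⟩
  have h' := (hasSum_nat_add_iff' 1).mpr h
  convert! h' using 1
  · funext n
    push_cast
    rfl
  · norm_num
    ring
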